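/- arXiv:2109.06981 — 8 statements merged into one kernel-verified Lean document; each statement's English description precedes it below -/
import Mathlib

section
/- Let A be an element of SL(2,ℤ) such that det(I − A) = 1 or det(I − A) = −1. Then A is conjugate in SL(2,ℤ) to one of the three matrices [[2,1],[1,1]], [[0,1],[−1,1]], or [[1,−1],[1,0]]. -/
open Matrix in
/-- Conjugation by `!![1, k; 0, 1]`. -/
lemma exists_isConj_shear (A : SpecialLinearGroup (Fin 2) ℤ) (k : ℤ) :
    ∃ B : SpecialLinearGroup (Fin 2) ℤ, IsConj A B ∧ B 0 0 = A 0 0 + k * A 1 0 ∧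
      B 1 0 = A 1 0 ∧ B 1 1 = A 1 1 - k * A 1 0 := by
  obtain ⟨P, hP⟩ : ∃ P : SpecialLinearGroup (Fin 2) ℤ,
      (P : Matrix (Fin 2) (Fin 2) ℤ) = !![1, k; 0, 1] :=
    ⟨⟨_, by simp [det_fin_two_of]⟩, rfl⟩
  refine ⟨P * A * P⁻¹, isConj_iff.2 ⟨P, rfl⟩, ?_, ?_, ?_⟩ <;>
    simp [hP, adjugate_fin_two, vecMul, dotProduct, Matrix.mul_apply, Fin.sum_univ_two] <;> ring

open Matrix in
/-- Conjugation by `!![0, -1; 1, 0]`. -/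
lemma exists_isConj_swap (A : SpecialLinearGroup (Fin 2) ℤ) :
    ∃ B : SpecialLinearGroup (Fin 2) ℤ, IsConj A B ∧ B 0 0 = A 1 1 ∧ B 0 1 = -A 1 0 ∧
      B 1 0 = -A 0 1 ∧ B 1 1 = A 0 0 := by
  obtain ⟨P, hP⟩ : ∃ P : SpecialLinearGroup (Fin 2) ℤ,
      (P : Matrix (Fin 2) (Fin 2) ℤ) = !![0, -1; 1, 0] :=
    ⟨⟨_, by simp [det_fin_two_of]⟩, rfl⟩
  refine ⟨P * A * P⁻¹, isConj_iff.2 ⟨P, rfl⟩, ?_, ?_, ?_, ?_⟩ <;>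
    simp [hP, adjugate_fin_two, vecMul, dotProduct, Matrix.mul_apply, Fin.sum_univ_two]

lemma Int.exists_abs_add_two_mul_le (m : ℤ) {c : ℤ} (hc : c ≠ 0) :
    ∃ k : ℤ, |m + 2 * (k * c)| ≤ |c| := by
  refine ⟨-((m + |c|) / (2 * c)), ?_⟩
  have h₁ := Int.emod_nonneg (m + |c|) (mul_ne_zero two_ne_zero hc)
  have h₂ := Int.emod_lt_abs (m + |c|) (mul_ne_zero two_ne_zero hc)
  have h₃ := Int.emod_add_mul_ediv (m + |c|) (2 * c)
  rw [abs_mul, abs_two] at h₂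
  rw [abs_le]
  constructor <;> linarith

/-- An element of `SL(2, ℤ)` of trace `1` or `3` has a conjugate, of the same trace, whose lower
left entry is `±1`. -/
lemma exists_isConj_abs_eq_one (A : Matrix.SpecialLinearGroup (Fin 2) ℤ)
    (ht : A 0 0 + A 1 1 = 1 ∨ A 0 0 + A 1 1 = 3) :
    ∃ B : Matrix.SpecialLinearGroup (Fin 2) ℤ, IsConj A B ∧
      B 0 0 + B 1 1 = A 0 0 + A 1 1 ∧ |B 1 0| = 1 := by
  induction hn : (A 1 0).natAbs using Nat.strong_induction_on generalizing A with
  | _ n ih =>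
  have hdet := A.det_coe
  rw [Matrix.det_fin_two] at hdet
  have hc : A 1 0 ≠ 0 := by
    intro h0
    rw [h0, mul_zero, sub_zero] at hdet
    rcases Int.eq_one_or_neg_one_of_mul_eq_one' hdet with h | h <;> omega
  by_cases h1 : |A 1 0| = 1
  · exact ⟨A, IsConj.refl A, rfl, h1⟩
  obtain ⟨k, hk⟩ := Int.exists_abs_add_two_mul_le (A 0 0 - A 1 1) hc
  obtain ⟨B, hAB, hB₁, hB₂, hB₃⟩ := exists_isConj_shear A k
  obtain ⟨C, hBC, hC₁, -, hC₂, hC₃⟩ := exists_isConj_swap B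
  have hdetB := B.det_coe
  rw [Matrix.det_fin_two] at hdetB
  have htr : C 0 0 + C 1 1 = A 0 0 + A 1 1 := by rw [hC₁, hC₃, hB₁, hB₃]; ring
  have hk' : (B 0 0 - B 1 1) ^ 2 ≤ B 1 0 ^ 2 := by
    apply sq_le_sq.2
    rw [hB₁, hB₂, hB₃]
    rwa [show A 0 0 + k * A 1 0 - (A 1 1 - k * A 1 0) = A 0 0 - A 1 1 + 2 * (k * A 1 0) by ring]
  have hc2 : 2 ≤ |B 1 0| := by
    have := abs_pos.2 hc
    rw [hB₂]
    omega
  have hlt : |B 0 1| < |B 1 0| := by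
    by_contra! hle
    have hmul : B 1 0 ^ 2 ≤ |B 0 1 * B 1 0| := by
      rw [abs_mul, ← sq_abs]
      nlinarith
    have hsq : 4 ≤ B 1 0 ^ 2 := by
      rw [← sq_abs]
      nlinarith
    have hbc : 4 * (B 0 1 * B 1 0) = (B 0 0 + B 1 1) ^ 2 - 4 - (B 0 0 - B 1 1) ^ 2 := by
      linear_combination -4 * hdetB
    have htB : B 0 0 + B 1 1 = A 0 0 + A 1 1 := by rw [hB₁, hB₃]; ring
    rw [htB] at hbc
    have hs := sq_nonneg (B 0 0 - B 1 1)
    rcases abs_cases (B 0 1 * B 1 0) with ⟨h, -⟩ | ⟨h, -⟩ <;> rcases ht with ht | ht <;>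
      rw [ht] at hbc <;> linarith
  obtain ⟨D, hCD, hD₁, hD₂⟩ := ih (C 1 0).natAbs
    (by rw [hC₂, Int.natAbs_neg, ← hn, ← hB₂]; exact Int.natAbs_lt_iff_sq_lt.2 (sq_lt_sq.2 hlt))
    C (by rwa [htr]) rfl
  exact ⟨D, (hAB.trans hBC).trans hCD, hD₁.trans htr, hD₂⟩

/-- An element of `SL(2, ℤ)` with lower left entry `ε = ±1` is conjugate to any element with the
same trace and the same lower left entry. -/
lemma isConj_of_trace_eq_of_lower_left_eq {A B : Matrix.SpecialLinearGroup (Fin 2) ℤ} {ε : ℤ}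
    (hε : ε = 1 ∨ ε = -1) (hA : A 1 0 = ε) (hB : B 1 0 = ε)
    (ht : A 0 0 + A 1 1 = B 0 0 + B 1 1) : IsConj A B := by
  obtain ⟨C, hAC, h₀, h₁, h₂⟩ := exists_isConj_shear A (ε * (B 0 0 - A 0 0))
  have hε2 : ε * ε = 1 := by rcases hε with rfl | rfl <;> rfl
  have e₀ : C 0 0 = B 0 0 := by rw [h₀, hA]; linear_combination (B 0 0 - A 0 0) * hε2
  have e₁ : C 1 0 = B 1 0 := by rw [h₁, hA, hB]
  have e₂ : C 1 1 = B 1 1 := by rw [h₂, hA]; linear_combination ht - (B 0 0 - A 0 0) * hε2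
  have hdetC := C.det_coe
  have hdetB := B.det_coe
  rw [Matrix.det_fin_two] at hdetB hdetC
  have e₃ : C 0 1 = B 0 1 := by
    rw [e₀, e₁, e₂, hB] at hdetC
    rw [hB] at hdetB
    linear_combination (C 0 1 - B 0 1) * (-hε2) + ε * (hdetB - hdetC)
  have hCB : C = B := by
    ext i j
    fin_cases i <;> fin_cases j <;> assumption
  exact hCB ▸ hAC

/-- Let `A ∈ SL(2,ℤ)` with `det (I - A) = ±1`. Then `A` is conjugate in
`SL(2,ℤ)` to one of `[[2,1],[1,1]]`, `[[0,1],[-1,1]]`, `[[1,-1],[1,0]]`. -/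
theorem sl2_det_one_sub_eq_pm_one_conj
    (A : Matrix.SpecialLinearGroup (Fin 2) ℤ)
    (h : ((1 : Matrix (Fin 2) (Fin 2) ℤ) - (A : Matrix (Fin 2) (Fin 2) ℤ)).det = 1 ∨
         ((1 : Matrix (Fin 2) (Fin 2) ℤ) - (A : Matrix (Fin 2) (Fin 2) ℤ)).det = -1) :
    ∃ P : Matrix.SpecialLinearGroup (Fin 2) ℤ,
      P * A * P⁻¹ = (⟨!![2, 1; 1, 1], by norm_num [Matrix.det_fin_two_of]⟩ :
          Matrix.SpecialLinearGroup (Fin 2) ℤ) ∨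
      P * A * P⁻¹ = (⟨!![0, 1; -1, 1], by norm_num [Matrix.det_fin_two_of]⟩ :
          Matrix.SpecialLinearGroup (Fin 2) ℤ) ∨
      P * A * P⁻¹ = (⟨!![1, -1; 1, 0], by norm_num [Matrix.det_fin_two_of]⟩ :
          Matrix.SpecialLinearGroup (Fin 2) ℤ) := by
  have hdet := A.det_coe
  rw [Matrix.det_fin_two] at hdet
  simp only [Matrix.det_fin_two, Matrix.sub_apply, Matrix.one_apply_eq, ne_eq, zero_ne_one,
    one_ne_zero, not_false_eq_true, Matrix.one_apply_ne] at h
  have ht : A 0 0 + A 1 1 = 1 ∨ A 0 0 + A 1 1 = 3 := by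
    rcases h with h | h
    · left; linear_combination hdet - h
    · right; linear_combination hdet - h
  obtain ⟨B, hAB, htr, hB⟩ := exists_isConj_abs_eq_one A ht
  rw [exists_or, exists_or]
  rcases ht with ht | ht <;> rw [ht] at htr <;> rcases eq_or_eq_neg_of_abs_eq hB with hB | hB
  · exact .inr (.inr (isConj_iff.1 (hAB.trans
      (isConj_of_trace_eq_of_lower_left_eq (.inl rfl) hB rfl htr))))
  · exact .inr (.inl (isConj_iff.1 (hAB.trans
      (isConj_of_trace_eq_of_lower_left_eq (.inr rfl) hB rfl htr))))
  · exact .inl (isConj_iff.1 (hAB.trans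
      (isConj_of_trace_eq_of_lower_left_eq (.inl rfl) hB rfl htr)))
  · left
    let D : Matrix.SpecialLinearGroup (Fin 2) ℤ :=
      ⟨!![1, -1; -1, 2], by norm_num [Matrix.det_fin_two_of]⟩
    have hBD : IsConj B D := isConj_of_trace_eq_of_lower_left_eq (.inr rfl) hB rfl htr
    obtain ⟨C, hDC, h₁, -, h₂, h₃⟩ := exists_isConj_swap D
    exact isConj_iff.1 (((hAB.trans hBD).trans hDC).trans
      (isConj_of_trace_eq_of_lower_left_eq (.inl rfl) h₂ rfl (by rw [h₁, h₃]; rfl)))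
end

section
/- Every matrix A ∈ SL(2,ℤ) with tr(A) = 3 is conjugate in SL(2,ℤ) to the matrix [[2,1],[1,1]]. -/
open Matrix in
/-- The entries of a conjugate in `SL(2,ℤ)`, in terms of matrices. -/
theorem sl2_conj_apply (P A : SpecialLinearGroup (Fin 2) ℤ) (i j : Fin 2) :
    (P * A * P⁻¹) i j =
      ((P : Matrix (Fin 2) (Fin 2) ℤ) * A * !![P 1 1, -P 0 1; -P 1 0, P 0 0]) i j := by
  rw [← adjugate_fin_two]
  rfl

open Matrix in
/-- The trace is a conjugacy invariant on `SL(2,ℤ)`. -/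
theorem sl2_trace_eq_of_isConj {A B : SpecialLinearGroup (Fin 2) ℤ} (h : IsConj A B) :
    B 0 0 + B 1 1 = A 0 0 + A 1 1 := by
  obtain ⟨P, rfl⟩ := isConj_iff.1 h
  have hP : P 0 0 * P 1 1 - P 0 1 * P 1 0 = 1 := by rw [← det_fin_two, P.det_coe]
  simp only [sl2_conj_apply, mul_apply, Fin.sum_univ_two, of_apply, cons_val_zero, cons_val_one,
    cons_val']
  linear_combination (A 0 0 + A 1 1) * hP

open Matrix in
/-- Conjugating by the shear `[[1,k],[0,1]]` adds `k` times the lower left entry to the upper left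
entry. -/
theorem sl2_exists_isConj_shear (A : SpecialLinearGroup (Fin 2) ℤ) (k : ℤ) :
    ∃ B, IsConj A B ∧ B 0 0 = A 0 0 + k * A 1 0 ∧ B 1 0 = A 1 0 := by
  obtain ⟨T, hT⟩ : ∃ T : SpecialLinearGroup (Fin 2) ℤ,
      (T : Matrix (Fin 2) (Fin 2) ℤ) = !![1, k; 0, 1] :=
    ⟨⟨!![1, k; 0, 1], by simp⟩, rfl⟩
  refine ⟨T * A * T⁻¹, isConj_iff.2 ⟨T, rfl⟩, ?_, ?_⟩ <;>
    simp [sl2_conj_apply, hT, mul_apply, vecMul, dotProduct, Fin.sum_univ_two]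

open Matrix in
/-- Conjugating by `[[0,-1],[1,0]]` swaps the diagonal and negates and swaps the antidiagonal. -/
theorem sl2_exists_isConj_swap (A : SpecialLinearGroup (Fin 2) ℤ) :
    ∃ B, IsConj A B ∧ B 0 0 = A 1 1 ∧ B 1 0 = -A 0 1 := by
  obtain ⟨S, hS⟩ : ∃ S : SpecialLinearGroup (Fin 2) ℤ,
      (S : Matrix (Fin 2) (Fin 2) ℤ) = !![0, -1; 1, 0] :=
    ⟨⟨!![0, -1; 1, 0], by simp⟩, rfl⟩
  refine ⟨S * A * S⁻¹, isConj_iff.2 ⟨S, rfl⟩, ?_, ?_⟩ <;>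
    simp [sl2_conj_apply, hS, mul_apply, vecMul, dotProduct, Fin.sum_univ_two]

/-- An integer of the form `2 * a - t` can be reduced modulo `2 * c` to absolute value at most
`|c|`, by changing `a` by a multiple of `c`. -/
theorem Int.exists_abs_two_mul_add_mul_sub_le (a t : ℤ) {c : ℤ} (hc : c ≠ 0) :
    ∃ k : ℤ, |2 * (a + k * c) - t| ≤ |c| := by
  have hpos : 0 < 2 * |c| := by positivity
  have h0 := Int.emod_nonneg (2 * a - t + |c|) hpos.ne'
  have h1 := Int.emod_lt_of_pos (2 * a - t + |c|) hpos
  have h2 := Int.emod_add_mul_ediv (2 * a - t + |c|) (2 * |c|)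
  set q := (2 * a - t + |c|) / (2 * |c|)
  rcases abs_choice c with h | h
  · refine ⟨-q, abs_le.2 ?_⟩
    rw [h] at h0 h1 h2 ⊢
    constructor <;> linarith
  · refine ⟨q, abs_le.2 ?_⟩
    rw [h] at h0 h1 h2 ⊢
    constructor <;> linarith

open Matrix in
/-- Gauss reduction: a matrix of trace `3` is conjugate to one whose lower left entry is `1`. -/
theorem sl2_exists_isConj_lower_left_eq_one (A : SpecialLinearGroup (Fin 2) ℤ)
    (h : A 0 0 + A 1 1 = 3) : ∃ B, IsConj A B ∧ B 1 0 = 1 := by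
  induction hn : (A 1 0).natAbs using Nat.strong_induction_on generalizing A with
  | _ n ih =>
  subst hn
  have hA : A 0 0 * A 1 1 - A 0 1 * A 1 0 = 1 := by rw [← det_fin_two, A.det_coe]
  have hc : A 1 0 ≠ 0 := by
    intro hc
    have h5 : (2 * A 0 0 - 3) ^ 2 = 5 := by
      rw [hc] at hA
      linear_combination 4 * A 0 0 * h - 4 * hA
    have hlt : |2 * A 0 0 - 3| < 3 := abs_lt_of_sq_lt_sq (by linarith) (by norm_num)
    obtain ⟨h₁, h₂⟩ := abs_lt.1 hlt
    generalize A 0 0 = a at *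
    have : a = 1 ∨ a = 2 := by omega
    rcases this with rfl | rfl <;> norm_num at h5
  obtain ⟨k, hk⟩ := Int.exists_abs_two_mul_add_mul_sub_le (A 0 0) 3 hc
  obtain ⟨B, hAB, hB₀, hB₁⟩ := sl2_exists_isConj_shear A k
  have htr := (sl2_trace_eq_of_isConj hAB).trans h
  have hB : B 0 0 * B 1 1 - B 0 1 * B 1 0 = 1 := by rw [← det_fin_two, B.det_coe]
  obtain ⟨C, hBC, -, hC⟩ := sl2_exists_isConj_swap B
  have hdisc : 4 * (B 0 1 * B 1 0) = 5 - (2 * B 0 0 - 3) ^ 2 := by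
    linear_combination 4 * B 0 0 * htr - 4 * hB
  rw [← hB₀, ← hB₁] at hk
  rw [← hB₁] at hc ih
  have hsq : (2 * B 0 0 - 3) ^ 2 ≤ B 1 0 ^ 2 := sq_le_sq.2 hk
  have hone : 1 ≤ (2 * B 0 0 - 3) ^ 2 := by
    have : 2 * B 0 0 - 3 ≠ 0 := by omega
    exact Int.add_one_le_iff.2 (sq_pos_of_ne_zero this)
  rcases (Int.one_le_abs hc).eq_or_lt with h1 | h1
  · rcases eq_or_eq_neg_of_abs_eq h1.symm with h1 | h1
    · exact ⟨B, hAB, h1⟩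
    · refine ⟨C, hAB.trans hBC, ?_⟩
      rw [h1] at hsq hdisc
      linarith
  · have hlt : |B 0 1| < |B 1 0| := by
      refine lt_of_mul_lt_mul_right ?_ (abs_nonneg (B 1 0))
      rw [← abs_mul, abs_mul_abs_self, abs_lt]
      have : 4 ≤ B 1 0 ^ 2 := by
        rw [← sq_abs]
        nlinarith
      constructor <;> nlinarith
    have hCB : (C 1 0).natAbs < (B 1 0).natAbs := by
      rw [hC, Int.natAbs_neg]
      exact Int.natAbs_lt_iff_sq_lt.2 (sq_lt_sq.2 hlt)
    obtain ⟨D, hCD, hD⟩ := ih _ hCB C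
      ((sl2_trace_eq_of_isConj hBC).trans htr) rfl
    exact ⟨D, (hAB.trans hBC).trans hCD, hD⟩

/-- Every `A ∈ SL(2,ℤ)` with trace `3` is conjugate in `SL(2,ℤ)` to
`[[2,1],[1,1]]`. -/
theorem sl2_trace_three_conj
    (A : Matrix.SpecialLinearGroup (Fin 2) ℤ)
    (h : Matrix.trace (A : Matrix (Fin 2) (Fin 2) ℤ) = 3) :
    ∃ P : Matrix.SpecialLinearGroup (Fin 2) ℤ,
      P * A * P⁻¹ = (⟨!![2, 1; 1, 1], by norm_num [Matrix.det_fin_two_of]⟩ :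
          Matrix.SpecialLinearGroup (Fin 2) ℤ) := by
  rw [Matrix.trace_fin_two] at h
  obtain ⟨B, hAB, hB⟩ := sl2_exists_isConj_lower_left_eq_one A h
  obtain ⟨C, hBC, hC₀, hC₁⟩ := sl2_exists_isConj_shear B (2 - B 0 0)
  have htr := (sl2_trace_eq_of_isConj (hAB.trans hBC)).trans h
  have hdet : C 0 0 * C 1 1 - C 0 1 * C 1 0 = 1 := by rw [← Matrix.det_fin_two, C.det_coe]
  rw [hB] at hC₀ hC₁
  have hC₀' : C 0 0 = 2 := by linarith
  have hC₂ : C 1 1 = 1 := by linarith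
  have hC₃ : C 0 1 = 1 := by
    rw [hC₀', hC₁, hC₂] at hdet
    linarith
  obtain ⟨P, hP⟩ := isConj_iff.1 (hAB.trans hBC)
  refine ⟨P, hP.trans ?_⟩
  ext i j
  fin_cases i <;> fin_cases j <;> simp [hC₀', hC₁, hC₂, hC₃]
end

section
/- Every matrix A ∈ SL(2,ℤ) with tr(A) = 1 is conjugate in SL(2,ℤ) to the matrix [[0,1],[−1,1]] or to its inverse [[1,−1],[1,0]]. -/
/-- Reduction theory in discriminant `-3`: an integral binary quadratic form
`c x² + (1 - 2a) x y - b y²` of discriminant `-3` represents `1` or `-1`. -/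
theorem exists_form_eq_one_or_neg_one (a b c : ℤ) (h : b * c = a - a ^ 2 - 1) :
    ∃ x y : ℤ, c * x ^ 2 + (1 - 2 * a) * x * y - b * y ^ 2 = 1 ∨
      c * x ^ 2 + (1 - 2 * a) * x * y - b * y ^ 2 = -1 := by
  induction hn : c.natAbs using Nat.strong_induction_on generalizing a b c with
  | _ n ih =>
  have hc : c ≠ 0 := by
    rintro rfl
    nlinarith [sq_nonneg (2 * a - 1)]
  by_cases h1 : |c| ≤ 1
  · refine ⟨1, 0, ?_⟩
    rw [abs_le] at h1
    have : c = 1 ∨ c = -1 := by omega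
    simpa using this
  have h2 : 2 ≤ |c| := by omega
  obtain ⟨k, hk⟩ : ∃ k : ℤ, |2 * (a + k * c) - 1| ≤ |c| := by
    refine ⟨-((2 * a - 1 + |c|) / (2 * c)), ?_⟩
    have e := Int.emod_add_mul_ediv (2 * a - 1 + |c|) (2 * c)
    have l := Int.emod_nonneg (2 * a - 1 + |c|) (mul_ne_zero two_ne_zero hc)
    have u := Int.emod_lt_abs (2 * a - 1 + |c|) (mul_ne_zero two_ne_zero hc)
    rw [abs_mul, abs_two] at u
    rw [abs_le]
    constructor <;> linarith
  obtain ⟨b', hb⟩ : ∃ b', b' = b + k - 2 * a * k - k ^ 2 * c := ⟨_, rfl⟩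
  have h' : b' * c = (a + k * c) - (a + k * c) ^ 2 - 1 := by
    rw [hb]
    linear_combination h
  have hlt : |b'| < |c| := by
    have hsq : (2 * (a + k * c) - 1) ^ 2 ≤ |c| ^ 2 := by
      rw [← sq_abs]
      gcongr
    have habs : |b'| * |c| = (a + k * c) ^ 2 - (a + k * c) + 1 := by
      rw [← abs_mul, h', abs_of_nonpos] <;> nlinarith [sq_nonneg (2 * (a + k * c) - 1)]
    by_contra! hle
    nlinarith
  obtain ⟨x, y, hxy⟩ := ih (-b').natAbs
    (by rwa [← hn, Int.natAbs_neg, Int.natAbs_lt_iff_sq_lt, sq_lt_sq])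
    (1 - (a + k * c)) (-c) (-b') (by linear_combination h') rfl
  refine ⟨y + k * x, -x, ?_⟩
  convert hxy using 2 <;> rw [hb] <;> ring

theorem inv_mul_mul_inv_inv_of_mul_eq {G : Type*} [Group G] {g h q : G} (e : g * q = q * h) :
    q⁻¹ * g * q⁻¹⁻¹ = h := by
  rw [inv_inv, mul_assoc, e, inv_mul_cancel_left]

/-- Every `A ∈ SL(2,ℤ)` with trace `1` is conjugate in `SL(2,ℤ)` to
`[[0,1],[-1,1]]` or to its inverse `[[1,-1],[1,0]]`. -/
theorem sl2_trace_one_conj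
    (A : Matrix.SpecialLinearGroup (Fin 2) ℤ)
    (h : Matrix.trace (A : Matrix (Fin 2) (Fin 2) ℤ) = 1) :
    ∃ P : Matrix.SpecialLinearGroup (Fin 2) ℤ,
      P * A * P⁻¹ = (⟨!![0, 1; -1, 1], by norm_num [Matrix.det_fin_two_of]⟩ :
          Matrix.SpecialLinearGroup (Fin 2) ℤ) ∨
      P * A * P⁻¹ = (⟨!![1, -1; 1, 0], by norm_num [Matrix.det_fin_two_of]⟩ :
          Matrix.SpecialLinearGroup (Fin 2) ℤ) := by
  obtain ⟨a, b, c, d, hdet, rfl⟩ : ∃ (a b c d : ℤ) (hdet : a * d - b * c = 1),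
      A = ⟨!![a, b; c, d], by rw [Matrix.det_fin_two_of, hdet]⟩ :=
    ⟨A 0 0, A 0 1, A 1 0, A 1 1, by rw [← Matrix.det_fin_two, A.det_coe],
      Subtype.ext (Matrix.eta_fin_two _)⟩
  rw [Matrix.trace_fin_two_of] at h
  obtain rfl : d = 1 - a := by linarith
  obtain ⟨x, y, hxy | hxy⟩ := exists_form_eq_one_or_neg_one a b c (by linarith)
  -- In the basis `v = (x, y)`, `A v - v`, the matrix is the second normal form.
  · have hQ : Matrix.det !![x, a * x + b * y - x; y, c * x + (1 - a) * y - y] = 1 := by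
      rw [Matrix.det_fin_two_of]
      linear_combination hxy
    have hmul : !![a, b; c, 1 - a] * !![x, a * x + b * y - x; y, c * x + (1 - a) * y - y] =
        !![x, a * x + b * y - x; y, c * x + (1 - a) * y - y] * !![1, -1; 1, 0] := by
      ext i j
      fin_cases i <;> fin_cases j <;> simp [Matrix.mul_apply, Fin.sum_univ_two] <;> grind
    exact ⟨(⟨_, hQ⟩ : Matrix.SpecialLinearGroup (Fin 2) ℤ)⁻¹,
      Or.inr (inv_mul_mul_inv_inv_of_mul_eq (Subtype.ext hmul))⟩
  -- In the basis `A v - v`, `v`, it is the first one.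
  · have hQ : Matrix.det !![a * x + b * y - x, x; c * x + (1 - a) * y - y, y] = 1 := by
      rw [Matrix.det_fin_two_of]
      linear_combination -hxy
    have hmul : !![a, b; c, 1 - a] * !![a * x + b * y - x, x; c * x + (1 - a) * y - y, y] =
        !![a * x + b * y - x, x; c * x + (1 - a) * y - y, y] * !![0, 1; -1, 1] := by
      ext i j
      fin_cases i <;> fin_cases j <;> simp [Matrix.mul_apply, Fin.sum_univ_two] <;> grind
    exact ⟨(⟨_, hQ⟩ : Matrix.SpecialLinearGroup (Fin 2) ℤ)⁻¹,
      Or.inl (inv_mul_mul_inv_inv_of_mul_eq (Subtype.ext hmul))⟩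
end

section
/- The centralizer of the matrix A₀ = [[2,1],[1,1]] in SL(2,ℤ) equals the subgroup of SL(2,ℤ) generated by A₀ and −I. -/
/-- The matrix `A₀ = [[2,1],[1,1]]` as an element of `SL(2,ℤ)`. -/
def fig8MonodromyMatrix : Matrix.SpecialLinearGroup (Fin 2) ℤ :=
  ⟨!![2, 1; 1, 1], by norm_num [Matrix.det_fin_two_of]⟩

/-- The central element `-I` of `SL(2,ℤ)`. -/
def negIdentitySL2 : Matrix.SpecialLinearGroup (Fin 2) ℤ :=
  ⟨!![-1, 0; 0, -1], by norm_num [Matrix.det_fin_two_of]⟩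

lemma coe_fig8MonodromyMatrix :
    (fig8MonodromyMatrix : Matrix (Fin 2) (Fin 2) ℤ) = !![2, 1; 1, 1] := rfl

lemma coe_negIdentitySL2 :
    (negIdentitySL2 : Matrix (Fin 2) (Fin 2) ℤ) = !![-1, 0; 0, -1] := rfl

/-- The matrices commuting with `A₀` are the symmetric ones of the form `[[a,b],[b,a-b]]`. -/
lemma mem_centralizer_fig8MonodromyMatrix_iff (P : Matrix.SpecialLinearGroup (Fin 2) ℤ) :
    P ∈ Subgroup.centralizer {fig8MonodromyMatrix} ↔
      P 1 0 = P 0 1 ∧ P 1 1 = P 0 0 - P 0 1 := by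
  rw [Subgroup.mem_centralizer_singleton_iff, Matrix.SpecialLinearGroup.ext_iff]
  simp only [Fin.forall_fin_two, Matrix.SpecialLinearGroup.coe_mul, coe_fig8MonodromyMatrix,
    Matrix.mul_apply, Fin.sum_univ_two, Matrix.of_apply, Matrix.cons_val]
  constructor
  · rintro ⟨⟨h₁, h₂⟩, h₃, h₄⟩
    constructor <;> linarith
  · rintro ⟨h₁, h₂⟩
    rw [h₁, h₂]
    refine ⟨⟨?_, ?_⟩, ?_, ?_⟩ <;> ring

lemma mul_fig8MonodromyMatrix_apply_zero_one (P : Matrix.SpecialLinearGroup (Fin 2) ℤ) :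
    (P * fig8MonodromyMatrix) 0 1 = P 0 0 + P 0 1 := by
  simp [coe_fig8MonodromyMatrix, Matrix.mul_apply, Fin.sum_univ_two]

lemma mul_inv_fig8MonodromyMatrix_apply_zero_one (P : Matrix.SpecialLinearGroup (Fin 2) ℤ) :
    (P * fig8MonodromyMatrix⁻¹) 0 1 = 2 * P 0 1 - P 0 0 := by
  simp [coe_fig8MonodromyMatrix, Matrix.mul_apply, Fin.sum_univ_two,
    Matrix.SpecialLinearGroup.coe_inv, Matrix.adjugate_fin_two]
  ring

/-- The descent step for the norm equation `a² - ab - b² = 1`. -/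
lemma natAbs_add_lt_or_natAbs_two_mul_sub_lt {a b : ℤ} (h : a * (a - b) - b * b = 1)
    (hb : b ≠ 0) : (a + b).natAbs < b.natAbs ∨ (2 * b - a).natAbs < b.natAbs := by
  have ha : a ≠ 0 := by
    rintro rfl
    nlinarith [mul_self_nonneg b]
  rcases lt_or_gt_of_ne ha with ha | ha <;> rcases lt_or_gt_of_ne hb with hb | hb
  · right
    have h₁ : a < b := by nlinarith
    have h₂ : 3 * b < a := by nlinarith
    omega
  · left
    have h₁ : -(2 * b) < a := by nlinarith
    omega
  · left
    have h₁ : a < -(2 * b) := by nlinarith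
    omega
  · right
    have h₁ : b < a := by nlinarith
    have h₂ : a < 3 * b := by nlinarith
    omega

lemma mem_closure_of_mem_centralizer_fig8MonodromyMatrix
    (P : Matrix.SpecialLinearGroup (Fin 2) ℤ)
    (hP : P ∈ Subgroup.centralizer {fig8MonodromyMatrix}) :
    P ∈ Subgroup.closure {fig8MonodromyMatrix, negIdentitySL2} := by
  have hA : fig8MonodromyMatrix ∈ Subgroup.closure {fig8MonodromyMatrix, negIdentitySL2} :=
    Subgroup.subset_closure (by simp)
  have hAc : fig8MonodromyMatrix ∈ Subgroup.centralizer {fig8MonodromyMatrix} :=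
    Subgroup.mem_centralizer_singleton_iff.2 rfl
  induction hn : (P 0 1).natAbs using Nat.strong_induction_on generalizing P with
  | _ n ih =>
    obtain ⟨h₁, h₂⟩ := (mem_centralizer_fig8MonodromyMatrix_iff P).1 hP
    have hdet := P.det_coe
    rw [Matrix.det_fin_two, h₁, h₂] at hdet
    by_cases hb : P 0 1 = 0
    · rw [hb] at h₁ h₂ hdet
      rcases mul_self_eq_one_iff.1 (show P 0 0 * P 0 0 = 1 by linarith) with ha | ha
      · have : P = 1 := by
          ext i j
          fin_cases i <;> fin_cases j <;> simp [ha, hb, h₁, h₂]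
        exact this ▸ one_mem _
      · have : P = negIdentitySL2 := by
          ext i j
          fin_cases i <;> fin_cases j <;> simp [ha, hb, h₁, h₂, coe_negIdentitySL2]
        exact this ▸ Subgroup.subset_closure (by simp)
    · rcases natAbs_add_lt_or_natAbs_two_mul_sub_lt hdet hb with h | h
      · rw [← mul_fig8MonodromyMatrix_apply_zero_one, hn] at h
        exact (Subgroup.mul_mem_cancel_right _ hA).1 (ih _ h _ (mul_mem hP hAc) rfl)
      · rw [← mul_inv_fig8MonodromyMatrix_apply_zero_one, hn] at h
        exact (Subgroup.mul_mem_cancel_right _ (inv_mem hA)).1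
          (ih _ h _ (mul_mem hP (inv_mem hAc)) rfl)

/-- The centralizer of `A₀ = [[2,1],[1,1]]` in `SL(2,ℤ)` equals the
subgroup generated by `A₀` and `-I`. -/
theorem sl2_centralizer_fig8_monodromy :
    Subgroup.centralizer {fig8MonodromyMatrix} =
      Subgroup.closure {fig8MonodromyMatrix, negIdentitySL2} := by
  refine le_antisymm mem_closure_of_mem_centralizer_fig8MonodromyMatrix ?_
  rw [Subgroup.closure_le]
  rintro P (rfl | rfl)
  · exact Subgroup.mem_centralizer_singleton_iff.2 rfl
  · exact (mem_centralizer_fig8MonodromyMatrix_iff _).2 (by simp [coe_negIdentitySL2])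
end

section
/- Let G be a finitely generated group with finite generating set S which is virtually free, i.e. G contains a free subgroup of finite index. Then every finitely generated subgroup H ≤ G, with finite generating set T ⊆ H, is quasi-isometrically embedded in G: there exist constants λ ≥ 1 and c ≥ 0 such that (1/λ)·|h|_T − c ≤ |h|_S ≤ λ·|h|_T + c for all h ∈ H. -/
/-- Word length of `g` with respect to a generating set `S`: the least `n` such that
`g` is a product of `n` elements of `S ∪ S⁻¹` (`0` for the identity). -/
noncomputable def wordLength {G : Type*} [Group G] (S : Set G) (g : G) : ℕ :=
  sInf {n : ℕ | ∃ w : List G, (∀ x ∈ w, x ∈ S ∨ x⁻¹ ∈ S) ∧ w.prod = g ∧ w.length = n}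

section WordLength

variable {G : Type*} [Group G] {S : Set G}

/-- Membership in the subgroup generated by `S` in terms of words in `S ∪ S⁻¹`. -/
theorem exists_list_of_mem_subgroup_closure {g : G} (hg : g ∈ Subgroup.closure S) :
    ∃ w : List G, (∀ x ∈ w, x ∈ S ∨ x⁻¹ ∈ S) ∧ w.prod = g :=
  Submonoid.exists_list_of_mem_closure (s := S ∪ S⁻¹) (by
    rwa [← Subgroup.closure_toSubmonoid, Subgroup.mem_toSubmonoid])

theorem wordLength_prod_le {w : List G} (hw : ∀ x ∈ w, x ∈ S ∨ x⁻¹ ∈ S) :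
    wordLength S w.prod ≤ w.length :=
  Nat.sInf_le ⟨w, hw, rfl, rfl⟩

theorem exists_list_length_eq_wordLength {g : G} (hg : g ∈ Subgroup.closure S) :
    ∃ w : List G, (∀ x ∈ w, x ∈ S ∨ x⁻¹ ∈ S) ∧ w.prod = g ∧ w.length = wordLength S g := by
  obtain ⟨w, hw, hwg⟩ := exists_list_of_mem_subgroup_closure hg
  exact Nat.sInf_mem (s := {n : ℕ | ∃ w : List G, (∀ x ∈ w, x ∈ S ∨ x⁻¹ ∈ S) ∧
    w.prod = g ∧ w.length = n}) ⟨_, w, hw, hwg, rfl⟩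

theorem wordLength_mul_le {g h : G} (hg : g ∈ Subgroup.closure S)
    (hh : h ∈ Subgroup.closure S) :
    wordLength S (g * h) ≤ wordLength S g + wordLength S h := by
  obtain ⟨v, hv, rfl, hvl⟩ := exists_list_length_eq_wordLength hg
  obtain ⟨w, hw, rfl, hwl⟩ := exists_list_length_eq_wordLength hh
  rw [← hvl, ← hwl, ← List.prod_append, ← List.length_append]
  refine wordLength_prod_le fun x hx => ?_
  rcases List.mem_append.1 hx with hx | hx
  exacts [hv x hx, hw x hx]

/-- A function on a group that grows by at most `C` along each generator is bounded by an affine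
function of the word length. -/
theorem le_add_mul_wordLength {f : G → ℕ} {C : ℕ}
    (hf : ∀ g s, s ∈ S ∨ s⁻¹ ∈ S → f (g * s) ≤ f g + C) {g : G} (hg : g ∈ Subgroup.closure S) :
    f g ≤ f 1 + C * wordLength S g := by
  obtain ⟨w, hw, rfl, hwl⟩ := exists_list_length_eq_wordLength hg
  rw [← hwl]
  clear hwl hg
  induction w using List.reverseRecOn with
  | nil => simp
  | append_singleton w x ih =>
    have h₁ := ih fun y hy => hw y (by simp [hy])
    have h₂ := hf w.prod x (hw x (by simp))
    simp only [List.prod_append, List.prod_singleton, List.length_append, List.length_singleton,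
      mul_add, mul_one]
    omega

end WordLength

theorem Set.Finite.setOf_mem_or_inv_mem {G : Type*} [Group G] {S : Set G} (hS : S.Finite) :
    {s : G | s ∈ S ∨ s⁻¹ ∈ S}.Finite :=
  hS.union (hS.preimage inv_injective.injOn)

theorem Set.Finite.exists_nat_forall_le {α : Type*} {s : Set α} (hs : s.Finite) (f : α → ℕ) :
    ∃ C, ∀ x ∈ s, f x ≤ C := by
  obtain ⟨C, hC⟩ := (hs.image f).bddAbove
  exact ⟨C, fun x hx => hC (Set.mem_image_of_mem f hx)⟩

/-- If `K` has finite index, then finitely many right translates of `K` cover the group. -/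
theorem Subgroup.exists_finite_forall_eq_mul {G : Type*} [Group G] (K : Subgroup G)
    [K.FiniteIndex] : ∃ R : Set G, R.Finite ∧ ∀ g : G, ∃ k : K, ∃ r ∈ R, g = k * r := by
  refine ⟨Set.range fun q : G ⧸ K => q.out⁻¹, Set.finite_range _, fun g => ?_⟩
  obtain ⟨k, hk⟩ := QuotientGroup.mk_out_eq_mul K g⁻¹
  refine ⟨k, _, ⟨(g⁻¹ : G), rfl⟩, ?_⟩
  simp [hk]

namespace FreeGroup

variable {α : Type*}

/-- The path traced by a word passes through all vertices of the path traced by any of its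
reductions. -/
theorem Red.exists_prefix_mk_eq {L₁ L₂ : List (α × Bool)} (h : Red L₁ L₂)
    {p : List (α × Bool)} (hp : p <+: L₂) : ∃ q, q <+: L₁ ∧ mk q = mk p := by
  induction h generalizing p with
  | refl => exact ⟨p, hp, rfl⟩
  | tail _ hstep ih =>
    obtain @⟨M, N, x, b⟩ := hstep
    obtain ⟨r, hr⟩ := hp
    rcases List.append_eq_append_iff.1 hr with ⟨a, rfl, -⟩ | ⟨c, rfl, rfl⟩
    · exact ih ⟨a ++ (x, b) :: (x, !b) :: N, by simp⟩
    · obtain ⟨q, hq, hqp⟩ := ih (p := M ++ (x, b) :: (x, !b) :: c) ⟨r, by simp⟩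
      exact ⟨q, hq, hqp.trans (Quot.sound Red.Step.not)⟩

variable [DecidableEq α]

theorem exists_prefix_of_prefix_toWord_mul {x y : FreeGroup α} {p : List (α × Bool)}
    (hp : p <+: (x * y).toWord) :
    (∃ q, q <+: x.toWord ∧ mk q = mk p) ∨ ∃ q, q <+: y.toWord ∧ x * mk q = mk p := by
  rw [toWord_mul] at hp
  obtain ⟨q, ⟨r, hr⟩, hqp⟩ := reduce.red.exists_prefix_mk_eq hp
  rcases List.append_eq_append_iff.1 hr with ⟨a, ha, -⟩ | ⟨c, rfl, hc⟩
  · exact .inl ⟨q, ⟨a, ha.symm⟩, hqp⟩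
  · refine .inr ⟨c, ⟨r, hc.symm⟩, ?_⟩
    rw [← hqp, ← mul_mk, mk_toWord]

theorem finite_setOf_mk_prefix {Q : Set (FreeGroup α)} (hQ : Q.Finite) :
    {v : FreeGroup α | ∃ x ∈ Q, ∃ q, q <+: x.toWord ∧ mk q = v}.Finite := by
  refine (hQ.biUnion fun x _ => ((x.toWord.inits.finite_toSet).image mk)).subset ?_
  rintro v ⟨x, hx, q, hq, rfl⟩
  exact Set.mem_biUnion hx ⟨q, (List.mem_inits _ _).2 hq, rfl⟩

theorem finite_setOf_mem_toWord {Q : Set (FreeGroup α)} (hQ : Q.Finite) :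
    {a : α × Bool | ∃ x ∈ Q, a ∈ x.toWord}.Finite := by
  refine (hQ.biUnion fun x _ => x.toWord.finite_toSet).subset ?_
  rintro a ⟨x, hx, ha⟩
  exact Set.mem_biUnion hx ha

end FreeGroup

section VirtuallyFree

open FreeGroup hiding map_mul map_inv map_one
open scoped Pointwise

variable {G α : Type*} [Group G] {φ : FreeGroup α →* G} {R : Set G}
  {κ : G → FreeGroup α} {ρ : G → G}

/-- The coordinates `κ` in the free group change by elements of a finite set along generators. -/
theorem finite_setOf_coordinate_increments (hφ : Function.Injective φ) (hR : R.Finite)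
    (hρ : ∀ g, ρ g ∈ R) (hκ : ∀ g, g = φ (κ g) * ρ g) {S : Set G} (hS : S.Finite) :
    ∃ Q : Set (FreeGroup α), Q.Finite ∧
      ∀ g s, s ∈ S ∨ s⁻¹ ∈ S → (κ g)⁻¹ * κ (g * s) ∈ Q := by
  refine ⟨φ ⁻¹' (R * {s : G | s ∈ S ∨ s⁻¹ ∈ S} * R⁻¹),
    ((hR.mul hS.setOf_mem_or_inv_mem).mul hR.inv).preimage hφ.injOn, fun g s hs => ?_⟩
  have h : φ ((κ g)⁻¹ * κ (g * s)) = ρ g * s * (ρ (g * s))⁻¹ := by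
    have h₁ : φ (κ g) = g * (ρ g)⁻¹ := eq_mul_inv_of_mul_eq (hκ g).symm
    have h₂ : φ (κ (g * s)) = g * s * (ρ (g * s))⁻¹ := eq_mul_inv_of_mul_eq (hκ _).symm
    rw [map_mul, map_inv, h₁, h₂]
    group
  rw [Set.mem_preimage, h]
  exact Set.mul_mem_mul (Set.mul_mem_mul (hρ g) hs) (Set.inv_mem_inv.2 (hρ _))

theorem exists_norm_coordinate_le [DecidableEq α] (hφ : Function.Injective φ)
    (hR : R.Finite) (hρ : ∀ g, ρ g ∈ R) (hκ : ∀ g, g = φ (κ g) * ρ g) {S : Set G} (hS : S.Finite) :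
    ∃ C : ℕ, ∀ g ∈ Subgroup.closure S, (κ g).norm ≤ (κ 1).norm + C * wordLength S g := by
  obtain ⟨Q, hQ, hκQ⟩ := finite_setOf_coordinate_increments hφ hR hρ hκ hS
  obtain ⟨C, hC⟩ := hQ.exists_nat_forall_le norm
  refine ⟨C, fun g hg => le_add_mul_wordLength (f := fun g => (κ g).norm) (fun g s hs => ?_) hg⟩
  calc (κ (g * s)).norm = (κ g * ((κ g)⁻¹ * κ (g * s))).norm := by rw [mul_inv_cancel_left]
    _ ≤ _ := (FreeGroup.norm_mul_le _ _).trans (Nat.add_le_add_left (hC _ (hκQ g s hs)) _)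

/-- Quasiconvexity: the geodesics in the free group from the identity to the coordinates of elements
of a finitely generated subgroup stay uniformly close to the subgroup. -/
theorem exists_finite_prefix_coordinate [DecidableEq α] (hφ : Function.Injective φ)
    (hR : R.Finite) (hρ : ∀ g, ρ g ∈ R) (hκ : ∀ g, g = φ (κ g) * ρ g) {T : Set G} (hT : T.Finite) :
    ∃ (A : Set (α × Bool)) (B : Set G), A.Finite ∧ B.Finite ∧
      ∀ h ∈ Subgroup.closure T, (∀ a ∈ (κ h).toWord, a ∈ A) ∧
        ∀ p, p <+: (κ h).toWord → ∃ k ∈ Subgroup.closure T, ∃ b ∈ B, φ (mk p) = k * b := by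
  obtain ⟨Q, hQ, hκQ⟩ := finite_setOf_coordinate_increments hφ hR hρ hκ hT
  have hQ' := hQ.insert (κ 1)
  refine ⟨_, insert 1 R⁻¹ * φ '' _, finite_setOf_mem_toWord hQ',
    (hR.inv.insert 1).mul ((finite_setOf_mk_prefix hQ').image φ), fun h hh => ?_⟩
  obtain ⟨w, hw, rfl⟩ := exists_list_of_mem_subgroup_closure hh
  clear hh
  induction w using List.reverseRecOn with
  | nil =>
    refine ⟨fun a ha => ⟨κ 1, Set.mem_insert _ _, ha⟩, fun p hp => ⟨1, one_mem _, φ (mk p), ?_,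
      (one_mul _).symm⟩⟩
    exact ⟨1, Set.mem_insert _ _, _,
      ⟨_, ⟨κ 1, Set.mem_insert _ _, p, hp, rfl⟩, rfl⟩, one_mul _⟩
  | append_singleton w x ih =>
    have hw' : ∀ y ∈ w, y ∈ T ∨ y⁻¹ ∈ T := fun y hy => hw y (by simp [hy])
    obtain ⟨ih₁, ih₂⟩ := ih hw'
    have hwT : w.prod ∈ Subgroup.closure T := by
      refine Subgroup.list_prod_mem _ fun y hy => ?_
      rcases hw' y hy with h | h
      exacts [Subgroup.subset_closure h, inv_mem_iff.1 (Subgroup.subset_closure h)]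
    have hq := hκQ w.prod x (hw x (by simp))
    have hmul : κ (w ++ [x]).prod = κ w.prod * ((κ w.prod)⁻¹ * κ (w.prod * x)) := by simp
    rw [hmul]
    set q := (κ w.prod)⁻¹ * κ (w.prod * x)
    constructor
    · intro a ha
      rcases List.mem_append.1 ((toWord_mul_sublist _ _).subset ha) with ha | ha
      exacts [ih₁ a ha, ⟨q, Set.mem_insert_of_mem _ hq, ha⟩]
    · intro p hp
      rcases exists_prefix_of_prefix_toWord_mul hp with ⟨r, hr, hrp⟩ | ⟨r, hr, hrp⟩
      · rw [← hrp]
        exact ih₂ r hr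
      · refine ⟨w.prod, hwT, (ρ w.prod)⁻¹ * φ (mk r), ?_, ?_⟩
        · exact Set.mul_mem_mul (Set.mem_insert_of_mem _ (Set.inv_mem_inv.2 (hρ _)))
            ⟨_, ⟨q, Set.mem_insert_of_mem _ hq, r, hr, rfl⟩, rfl⟩
        · rw [← hrp, map_mul, ← mul_assoc, ← eq_mul_inv_of_mul_eq (hκ w.prod).symm]

/-- If a path in the free group stays close to the subgroup generated by `T`, then the word length
with respect to `T` is at most linear in the length of the path. -/
theorem exists_wordLength_le_of_prefix (φ : FreeGroup α →* G) {A : Set (α × Bool)} {B : Set G}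
    (hA : A.Finite) (hB : B.Finite) (T : Set G) :
    ∃ D : ℕ, ∀ w : List (α × Bool), (∀ a ∈ w, a ∈ A) →
      (∀ p, p <+: w → ∃ k ∈ Subgroup.closure T, ∃ b ∈ B, φ (mk p) = k * b) →
      ∀ h ∈ Subgroup.closure T, ∀ b ∈ B, φ (mk w) = h * b →
        wordLength T h ≤ D * (w.length + 1) := by
  have hE := hB.inv.union ((hB.mul (hA.image fun a => φ (mk [a]))).mul hB.inv)
  obtain ⟨D, hD⟩ := hE.exists_nat_forall_le (wordLength T)
  refine ⟨D, fun w => ?_⟩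
  induction w using List.reverseRecOn with
  | nil =>
    intro _ _ h _ b hb hhb
    have h_eq : h = b⁻¹ := eq_inv_of_mul_eq_one_left (hhb.symm.trans (map_one φ))
    simpa using hD h (.inl (by simpa [h_eq] using hb))
  | append_singleton w a ih =>
    intro hwA hw h hh b hb hhb
    obtain ⟨k, hk, c, hc, hkc⟩ := hw w (List.prefix_append _ _)
    have ihw := ih (fun a ha => hwA a (by simp [ha]))
      (fun p hp => hw p (hp.trans (List.prefix_append _ _))) k hk c hc hkc
    have hstep : k⁻¹ * h = c * φ (mk [a]) * b⁻¹ := by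
      rw [eq_mul_inv_iff_mul_eq, mul_assoc, ← hhb, ← mul_mk, map_mul, hkc]
      group
    have hmem : k⁻¹ * h ∈ B * ((fun a => φ (mk [a])) '' A) * B⁻¹ := by
      rw [hstep]
      exact Set.mul_mem_mul (Set.mul_mem_mul hc ⟨a, hwA a (by simp), rfl⟩) (Set.inv_mem_inv.2 hb)
    have hle := wordLength_mul_le hk (mul_mem (inv_mem hk) hh)
    rw [mul_inv_cancel_left] at hle
    have := hD _ (.inr hmem)
    rw [List.length_append, List.length_singleton, mul_add_one]
    omega

theorem exists_wordLength_le_norm_coordinate [DecidableEq α] (hφ : Function.Injective φ)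
    (hR : R.Finite) (hρ : ∀ g, ρ g ∈ R) (hκ : ∀ g, g = φ (κ g) * ρ g) {T : Set G} (hT : T.Finite) :
    ∃ D : ℕ, ∀ h ∈ Subgroup.closure T, wordLength T h ≤ D * ((κ h).norm + 1) := by
  obtain ⟨A, B, hA, hB, hAB⟩ := exists_finite_prefix_coordinate hφ hR hρ hκ hT
  obtain ⟨D, hD⟩ := exists_wordLength_le_of_prefix φ hA (hB.union hR.inv) T
  refine ⟨D, fun h hh => hD (κ h).toWord (hAB h hh).1 (fun p hp => ?_) h hh (ρ h)⁻¹
    (.inr (Set.inv_mem_inv.2 (hρ h))) ?_⟩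
  · obtain ⟨k, hk, b, hb, hkb⟩ := (hAB h hh).2 p hp
    exact ⟨k, hk, b, .inl hb, hkb⟩
  · rw [mk_toWord]
    exact eq_mul_inv_of_mul_eq (hκ h).symm

end VirtuallyFree

/-- In a virtually free group, word length in a finitely generated subgroup is bounded by an affine
function of the word length in the whole group. -/
theorem exists_wordLength_subgroup_le {G : Type*} [Group G] (K : Subgroup G) [K.FiniteIndex]
    [IsFreeGroup K] {S T : Set G} (hS : S.Finite) (hT : T.Finite) :
    ∃ a c : ℕ, ∀ h ∈ Subgroup.closure T, h ∈ Subgroup.closure S →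
      wordLength T h ≤ a * wordLength S h + c := by
  classical
  let φ : FreeGroup (IsFreeGroup.Generators K) →* G :=
    K.subtype.comp (IsFreeGroup.toFreeGroup K).symm.toMonoidHom
  have hφ : Function.Injective φ :=
    K.subtype_injective.comp (IsFreeGroup.toFreeGroup K).symm.injective
  obtain ⟨R, hR, hKR⟩ := K.exists_finite_forall_eq_mul
  choose k ρ hρ hk using hKR
  have hκ : ∀ g, g = φ (IsFreeGroup.toFreeGroup K (k g)) * ρ g := fun g => by
    simpa [φ] using hk g
  obtain ⟨C, hC⟩ := exists_norm_coordinate_le hφ hR hρ hκ hS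
  obtain ⟨D, hD⟩ := exists_wordLength_le_norm_coordinate hφ hR hρ hκ hT
  refine ⟨D * C, D * ((IsFreeGroup.toFreeGroup K (k 1)).norm + 1), fun h hT hS => ?_⟩
  calc _ ≤ _ := hD h hT
    _ ≤ D * ((IsFreeGroup.toFreeGroup K (k 1)).norm + C * wordLength S h + 1) := by
      gcongr
      exact hC h hS
    _ = _ := by ring

/-- Let `G` be a finitely generated virtually free group with finite
generating set `S`. Then every finitely generated subgroup `H ≤ G` with finite
generating set `T ⊆ H` is quasi-isometrically embedded in `G`. -/
theorem subgroup_of_virtually_free_group_qi_embedded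
    {G : Type*} [Group G]
    (hvf : ∃ K : Subgroup G, K.FiniteIndex ∧ IsFreeGroup K)
    (S : Set G) (hSfin : S.Finite) (hSgen : Subgroup.closure S = ⊤)
    (H : Subgroup G) (T : Set G) (hTfin : T.Finite) (hTsub : T ⊆ (H : Set G))
    (hTgen : Subgroup.closure T = H) :
    ∃ lam c : ℝ, 1 ≤ lam ∧ 0 ≤ c ∧ ∀ h ∈ H,
      (1 / lam) * (wordLength T h : ℝ) - c ≤ (wordLength S h : ℝ) ∧
      (wordLength S h : ℝ) ≤ lam * (wordLength T h : ℝ) + c := by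
  obtain ⟨K, hK, hKfree⟩ := hvf
  obtain ⟨a, c, hac⟩ := exists_wordLength_subgroup_le K hSfin hTfin
  obtain ⟨M, hM⟩ := hTfin.setOf_mem_or_inv_mem.exists_nat_forall_le (wordLength S)
  have hS : ∀ g, g ∈ Subgroup.closure S := fun g => hSgen ▸ Subgroup.mem_top g
  subst hTgen
  refine ⟨1 + a + M, c, by linarith [a.cast_nonneg (α := ℝ), M.cast_nonneg (α := ℝ)],
    c.cast_nonneg, fun h hh => ⟨?_, ?_⟩⟩
  · have h₁ : (wordLength T h : ℝ) ≤ a * wordLength S h + c := mod_cast hac h hh (hS h)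
    rw [one_div, sub_le_iff_le_add, inv_mul_le_iff₀ (by positivity)]
    have : 0 ≤ (1 + M : ℝ) * wordLength S h := by positivity
    have : 0 ≤ (a + M : ℝ) * c := by positivity
    linarith
  · have h₁ := le_add_mul_wordLength (f := wordLength S) (C := M) (fun g s hs =>
      (wordLength_mul_le (hS g) (hS s)).trans (Nat.add_le_add_left (hM s hs) _)) hh
    have h₂ : wordLength S (1 : G) = 0 :=
      Nat.le_zero.1 (wordLength_prod_le (w := []) (by simp))
    rw [h₂, zero_add] at h₁
    have h₃ : (wordLength S h : ℝ) ≤ M * wordLength T h := mod_cast h₁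
    have : 0 ≤ (1 + a : ℝ) * wordLength T h := by positivity
    have : (0 : ℝ) ≤ c := c.cast_nonneg
    linarith
end

section
/- Let G = ℤ * (ℤ/3ℤ) be the free product of an infinite cyclic group generated by b and a cyclic group of order 3 generated by d. For every integer n ≥ 2, no nontrivial element of the subgroup of G generated by bⁿd and dbⁿ is conjugate in G to an element of the free factor ⟨b⟩, nor to an element of the free factor ⟨d⟩. -/
open Monoid

/-- The generator of the infinite cyclic free factor of `ℤ * (ℤ/3ℤ)`. -/
def freeProdB : Coprod (Multiplicative ℤ) (Multiplicative (ZMod 3)) :=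
  Coprod.inl (Multiplicative.ofAdd (1 : ℤ))

/-- The generator of the order-3 free factor of `ℤ * (ℤ/3ℤ)`. -/
def freeProdD : Coprod (Multiplicative ℤ) (Multiplicative (ZMod 3)) :=
  Coprod.inr (Multiplicative.ofAdd (1 : ZMod 3))

/-- The shears `(u, v) ↦ (u + 10 m v, v)` of `ℤ²`, as a homomorphism in `m`. -/
def shearHom : Multiplicative ℤ →* (ℤ × ℤ) ≃ₗ[ℤ] (ℤ × ℤ) where
  toFun m :=
    { toFun := fun p => (p.1 + 10 * m.toAdd * p.2, p.2)
      invFun := fun p => (p.1 - 10 * m.toAdd * p.2, p.2)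
      left_inv := fun p => by ext <;> simp
      right_inv := fun p => by ext <;> simp
      map_add' := fun p q => by ext <;> simp; ring
      map_smul' := fun c p => by ext <;> simp; ring }
  map_one' := by ext p <;> simp
  map_mul' m m' := by
    ext p <;> simp [LinearEquiv.mul_apply]
    ring

/-- The automorphism `(u, v) ↦ (-v, u - v)` of `ℤ²`, of order three. -/
def orderThreeAut : (ℤ × ℤ) ≃ₗ[ℤ] (ℤ × ℤ) where
  toFun p := (-p.2, p.1 - p.2)
  invFun p := (p.2 - p.1, -p.1)
  left_inv p := by ext <;> simp
  right_inv p := by ext <;> simp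
  map_add' p q := by ext <;> simp <;> ring
  map_smul' c p := by ext <;> simp [mul_sub]

lemma shearHom_apply (m : Multiplicative ℤ) (p : ℤ × ℤ) :
    shearHom m p = (p.1 + 10 * m.toAdd * p.2, p.2) := rfl

lemma orderThreeAut_apply (p : ℤ × ℤ) : orderThreeAut p = (-p.2, p.1 - p.2) := rfl

lemma orderThreeAut_inv_apply (p : ℤ × ℤ) : orderThreeAut⁻¹ p = (p.2 - p.1, -p.1) := rfl

lemma orderThreeAut_pow_three : orderThreeAut ^ 3 = 1 := by
  ext p <;> simp [pow_succ, LinearEquiv.mul_apply, orderThreeAut_apply]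
  ring

/-- The homomorphism from `ℤ/3ℤ` sending the generator to `orderThreeAut`. -/
def orderThreeHom : Multiplicative (ZMod 3) →* (ℤ × ℤ) ≃ₗ[ℤ] (ℤ × ℤ) :=
  AddMonoidHom.toMultiplicativeLeft
    (ZMod.lift 3 ⟨zmultiplesHom (Additive ((ℤ × ℤ) ≃ₗ[ℤ] (ℤ × ℤ)))
      (Additive.ofMul orderThreeAut), by
      rw [zmultiplesHom_apply, natCast_zsmul, ← ofMul_pow, orderThreeAut_pow_three, ofMul_one]⟩)

lemma orderThreeHom_ofAdd_one : orderThreeHom (Multiplicative.ofAdd 1) = orderThreeAut := by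
  have h := ZMod.lift_coe 3 (A := Additive ((ℤ × ℤ) ≃ₗ[ℤ] (ℤ × ℤ)))
    ⟨zmultiplesHom (Additive ((ℤ × ℤ) ≃ₗ[ℤ] (ℤ × ℤ))) (Additive.ofMul orderThreeAut), by
      rw [zmultiplesHom_apply, natCast_zsmul, ← ofMul_pow, orderThreeAut_pow_three, ofMul_one]⟩ 1
  rw [Int.cast_one] at h
  change Additive.toMul (ZMod.lift 3 _ (1 : ZMod 3)) = orderThreeAut
  rw [h]
  simp

/-- The representation of `ℤ * (ℤ/3ℤ)` on `ℤ²` by shears and an order-three automorphism. -/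
def planeRep : Coprod (Multiplicative ℤ) (Multiplicative (ZMod 3)) →* (ℤ × ℤ) ≃ₗ[ℤ] (ℤ × ℤ) :=
  Coprod.lift shearHom orderThreeHom

lemma planeRep_freeProdD : planeRep freeProdD = orderThreeAut := by
  rw [planeRep, freeProdD, Coprod.lift_apply_inr, orderThreeHom_ofAdd_one]

lemma planeRep_freeProdB_pow (n : ℕ) :
    planeRep (freeProdB ^ n) = shearHom (Multiplicative.ofAdd (n : ℤ)) := by
  rw [planeRep, freeProdB, ← map_pow, Coprod.lift_apply_inl, ← ofAdd_nsmul, nsmul_one]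

lemma planeRep_inl_sq_apply (m : Multiplicative ℤ) (p : ℤ × ℤ) :
    planeRep (Coprod.inl m) (planeRep (Coprod.inl m) p) + p =
      planeRep (Coprod.inl m) p + planeRep (Coprod.inl m) p := by
  rw [planeRep, Coprod.lift_apply_inl]
  ext <;> simp [shearHom_apply]
  ring

/-- The two generators `bⁿd` (at `false`) and `dbⁿ` (at `true`). -/
def pingPongGen (n : ℕ) (i : Bool) : Coprod (Multiplicative ℤ) (Multiplicative (ZMod 3)) :=
  if i then freeProdD * freeProdB ^ n else freeProdB ^ n * freeProdD

/-- The letter of the free group on `pingPongGen` acting on `ℤ²`. -/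
def letterAction (n : ℕ) (a : Bool × Bool) : (ℤ × ℤ) ≃ₗ[ℤ] (ℤ × ℤ) :=
  planeRep (cond a.2 (pingPongGen n a.1) (pingPongGen n a.1)⁻¹)

/-- The attracting cone of each letter, where `N` is the displacement of the shear `bⁿ`. -/
def pingPongCone (N : ℤ) (a : Bool × Bool) (p : ℤ × ℤ) : Prop :=
  match a with
  | (false, true) => |p.1 - N * p.2| ≤ 2 * |p.2|
  | (true, true) => 4 * |p.1| ≤ |p.2 - p.1|
  | (false, false) => 4 * |p.1 - p.2| ≤ |p.2|
  | (true, false) => |p.1 + N * p.2| ≤ 2 * |p.2|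

/-- The `ℓ¹` norm on `ℤ²`. -/
def planeNorm (p : ℤ × ℤ) : ℤ := |p.1| + |p.2|

lemma letterAction_false_true (n : ℕ) (p : ℤ × ℤ) :
    letterAction n (false, true) p = (-p.2 + 10 * n * (p.1 - p.2), p.1 - p.2) := by
  simp [letterAction, pingPongGen, planeRep_freeProdB_pow, planeRep_freeProdD, LinearEquiv.mul_apply,
    shearHom_apply, orderThreeAut_apply, -map_pow]

lemma letterAction_true_true (n : ℕ) (p : ℤ × ℤ) :
    letterAction n (true, true) p = (-p.2, p.1 + 10 * n * p.2 - p.2) := by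
  simp [letterAction, pingPongGen, planeRep_freeProdB_pow, planeRep_freeProdD, LinearEquiv.mul_apply,
    shearHom_apply, orderThreeAut_apply, -map_pow]

lemma letterAction_false_false (n : ℕ) (p : ℤ × ℤ) :
    letterAction n (false, false) p = (p.2 - (p.1 - 10 * n * p.2), -(p.1 - 10 * n * p.2)) := by
  simp only [letterAction, pingPongGen, cond_false, Bool.false_eq_true, if_false, mul_inv_rev,
    map_mul, map_inv, planeRep_freeProdB_pow, planeRep_freeProdD, LinearEquiv.mul_apply,
    orderThreeAut_inv_apply]
  rw [← map_inv, shearHom_apply]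
  simp [sub_eq_add_neg]

lemma letterAction_true_false (n : ℕ) (p : ℤ × ℤ) :
    letterAction n (true, false) p = (p.2 - p.1 + 10 * n * p.1, -p.1) := by
  simp only [letterAction, pingPongGen, cond_false, if_true, mul_inv_rev,
    map_mul, map_inv, planeRep_freeProdB_pow, planeRep_freeProdD, LinearEquiv.mul_apply,
    orderThreeAut_inv_apply]
  rw [← map_inv, shearHom_apply]
  simp

lemma twenty_mul_abs_le_abs_mul {N : ℤ} (hN : 20 ≤ N) (z : ℤ) : 20 * |z| ≤ |N * z| := by
  rw [abs_mul, abs_of_nonneg (by omega : 0 ≤ N)]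
  exact mul_le_mul_of_nonneg_right hN (abs_nonneg z)

lemma letterAction_mem_cone {n : ℕ} (hn : 2 ≤ n) {a c : Bool × Bool} (hac : a.1 = c.1 → a.2 = c.2)
    {p : ℤ × ℤ} (hp : pingPongCone (10 * n) c p) :
    pingPongCone (10 * n) a (letterAction n a p) ∧
      3 * planeNorm p ≤ 2 * planeNorm (letterAction n a p) := by
  obtain ⟨u, v⟩ := p
  have hN : (20 : ℤ) ≤ 10 * n := by omega
  have hu := twenty_mul_abs_le_abs_mul hN u
  have hv := twenty_mul_abs_le_abs_mul hN v
  have huv := twenty_mul_abs_le_abs_mul hN (u - v)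
  obtain ⟨_ | _, _ | _⟩ := a <;> obtain ⟨_ | _, _ | _⟩ := c <;>
    simp only [letterAction_false_true, letterAction_true_true, letterAction_false_false,
      letterAction_true_false, pingPongCone, planeNorm, forall_const, reduceCtorEq,
      imp_false] at hac hp ⊢ <;>
    generalize (10 * n : ℤ) = N at * <;>
    simp only [mul_sub, mul_add, mul_neg] at * <;>
    generalize N * u = U at * <;>
    generalize N * v = V at * <;>
    clear hN <;>
    grind

lemma exists_mem_cone (n : ℕ) (a : Bool × Bool) :
    ∃ p, pingPongCone (10 * n) a p ∧ 0 < planeNorm p := by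
  obtain ⟨_ | _, _ | _⟩ := a
  · exact ⟨(1, 1), by simp [pingPongCone, planeNorm]⟩
  · exact ⟨(10 * n, 1), by simp [pingPongCone, planeNorm]⟩
  · exact ⟨(-(10 * n), 1), by simp [pingPongCone, planeNorm]⟩
  · exact ⟨(0, 1), by simp [pingPongCone, planeNorm]⟩

lemma word_mem_cone {n : ℕ} (hn : 2 ≤ n) {c : Bool × Bool} {p : ℤ × ℤ}
    (hp : pingPongCone (10 * n) c p) (L : List (Bool × Bool)) (a : Bool × Bool)
    (hL : FreeGroup.IsReduced (a :: L))
    (hc : ∀ x ∈ (a :: L).getLast?, x.1 = c.1 → x.2 = c.2) :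
    pingPongCone (10 * n) a (((a :: L).map (letterAction n)).prod p) ∧
      3 * planeNorm p ≤ 2 * planeNorm (((a :: L).map (letterAction n)).prod p) := by
  induction L generalizing a with
  | nil => simpa using letterAction_mem_cone hn (hc a (by simp)) hp
  | cons e L ih =>
    rw [FreeGroup.isReduced_cons_cons] at hL
    obtain ⟨h₁, h₂⟩ := ih e hL.2 (by simpa using hc)
    obtain ⟨h₃, h₄⟩ := letterAction_mem_cone hn hL.1 h₁
    rw [List.map_cons, List.prod_cons, LinearEquiv.mul_apply]
    refine ⟨h₃, ?_⟩
    have : 0 ≤ 2 * planeNorm (((e :: L).map (letterAction n)).prod p) := by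
      unfold planeNorm
      positivity
    linarith

lemma planeRep_lift_mk (n : ℕ) (L : List (Bool × Bool)) :
    planeRep (FreeGroup.lift (pingPongGen n) (FreeGroup.mk L)) =
      (L.map (letterAction n)).prod := by
  rw [FreeGroup.lift_mk, map_list_prod, List.map_map]
  rfl

/-- A nontrivial element of `⟨bⁿd, dbⁿ⟩` has a conjugate that stretches the whole forward orbit of
some nonzero vector. -/
lemma exists_conj_expanding {n : ℕ} (hn : 2 ≤ n)
    {g : Coprod (Multiplicative ℤ) (Multiplicative (ZMod 3))}
    (hg : g ∈ Subgroup.closure {freeProdB ^ n * freeProdD, freeProdD * freeProdB ^ n})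
    (hg1 : g ≠ 1) :
    ∃ c h, g = c * h * c⁻¹ ∧ ∃ p, 0 < planeNorm p ∧ ∀ k : ℕ,
      3 * planeNorm (planeRep (h ^ k) p) ≤ 2 * planeNorm (planeRep (h ^ (k + 1)) p) := by
  have hrange : Set.range (pingPongGen n) =
      {freeProdB ^ n * freeProdD, freeProdD * freeProdB ^ n} := by
    ext z
    simp [pingPongGen]
  rw [← hrange, ← FreeGroup.range_lift_eq_closure] at hg
  obtain ⟨w, rfl⟩ := hg
  have hred := FreeGroup.reduceCyclically.isCyclicallyReduced (FreeGroup.isReduced_toWord (x := w))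
  have hw : w = FreeGroup.mk (FreeGroup.reduceCyclically.conjugator w.toWord) *
      FreeGroup.mk (FreeGroup.reduceCyclically w.toWord) *
      (FreeGroup.mk (FreeGroup.reduceCyclically.conjugator w.toWord))⁻¹ := by
    rw [FreeGroup.inv_mk, FreeGroup.mul_mk, FreeGroup.mul_mk,
      FreeGroup.reduceCyclically.conj_conjugator_reduceCyclically, FreeGroup.mk_toWord]
  generalize FreeGroup.reduceCyclically.conjugator w.toWord = C at hw
  generalize FreeGroup.reduceCyclically w.toWord = L at hw hred
  refine ⟨FreeGroup.lift (pingPongGen n) (FreeGroup.mk C),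
    FreeGroup.lift (pingPongGen n) (FreeGroup.mk L), ?_, ?_⟩
  · rw [hw]
    simp only [map_mul, map_inv]
  · cases L with
    | nil =>
      refine absurd ?_ hg1
      rw [hw, ← FreeGroup.one_eq_mk, mul_one, mul_inv_cancel, map_one]
    | cons a L =>
      obtain ⟨p, hp, hp0⟩ := exists_mem_cone n a
      have step {q : ℤ × ℤ} (hq : pingPongCone (10 * n) a q) :=
        word_mem_cone hn hq L a hred.isReduced fun x hx => hred.2 x hx a (by simp)
      refine ⟨p, hp0, fun k => ?_⟩
      have hmem : pingPongCone (10 * n) a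
          (planeRep (FreeGroup.lift (pingPongGen n) (FreeGroup.mk (a :: L)) ^ k) p) := by
        induction k with
        | zero => simpa using hp
        | succ k ih =>
          rw [pow_succ', map_mul, LinearEquiv.mul_apply, planeRep_lift_mk]
          exact (step ih).1
      rw [pow_succ', map_mul planeRep, LinearEquiv.mul_apply, planeRep_lift_mk]
      exact (step hmem).2

/-- In `G = ℤ * (ℤ/3ℤ)` with factors generated by `b` and `d`, for every
`n ≥ 2`, no nontrivial element of `⟨bⁿd, dbⁿ⟩` is conjugate in `G` to an element of the
free factor `⟨b⟩`, nor to an element of the free factor `⟨d⟩`. -/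
theorem no_conjugate_into_free_factors (n : ℕ) (hn : 2 ≤ n) :
    ∀ g ∈ Subgroup.closure {freeProdB ^ n * freeProdD, freeProdD * freeProdB ^ n},
      g ≠ 1 → ∀ k : Coprod (Multiplicative ℤ) (Multiplicative (ZMod 3)),
        k * g * k⁻¹ ∉ MonoidHom.range
            (Coprod.inl : Multiplicative ℤ →* Coprod (Multiplicative ℤ) (Multiplicative (ZMod 3))) ∧
        k * g * k⁻¹ ∉ MonoidHom.range
            (Coprod.inr : Multiplicative (ZMod 3) →*
              Coprod (Multiplicative ℤ) (Multiplicative (ZMod 3))) := by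
  intro g hg hg1 k
  obtain ⟨c, h, rfl, p, hp, hexp⟩ := exists_conj_expanding hn hg hg1
  have h₀ := hexp 0
  have h₁ := hexp 1
  have h₂ := hexp 2
  simp only [pow_zero, map_one, LinearEquiv.coe_one, id_eq, zero_add, Nat.reduceAdd] at h₀ h₁ h₂
  have hcube : h ^ 3 = (k * c)⁻¹ * (k * (c * h * c⁻¹) * k⁻¹) ^ 3 * (k * c) := by
    simp [pow_succ, mul_assoc]
  constructor
  · rintro ⟨m, hm⟩
    rw [← hm, ← map_pow] at hcube
    have hlin : planeRep (h ^ 6) p + p = planeRep (h ^ 3) p + planeRep (h ^ 3) p := by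
      have := congrArg (planeRep (k * c)⁻¹)
        (planeRep_inl_sq_apply (m ^ 3) (planeRep (k * c) p))
      simp only [map_add, ← LinearEquiv.mul_apply, ← map_mul] at this
      rw [show h ^ 6 = h ^ 3 * h ^ 3 from pow_add h 3 3, hcube]
      simpa [mul_assoc] using this
    have h₃ := hexp 3
    have h₄ := hexp 4
    have h₅ := hexp 5
    simp only [Nat.reduceAdd] at h₃ h₄ h₅
    have htri : planeNorm (planeRep (h ^ 6) p) ≤
        2 * planeNorm (planeRep (h ^ 3) p) + planeNorm p := by
      have e₁ := congrArg Prod.fst hlin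
      have e₂ := congrArg Prod.snd hlin
      simp only [Prod.fst_add, Prod.snd_add] at e₁ e₂
      unfold planeNorm
      grind
    linarith
  · rintro ⟨m, hm⟩
    have hm3 : ∀ z : Multiplicative (ZMod 3), z ^ 3 = 1 := by decide
    rw [← hm, ← map_pow, hm3, map_one, mul_one, inv_mul_cancel] at hcube
    simp only [hcube, map_one, LinearEquiv.coe_one, id_eq] at h₂
    linarith
end

section
/- Let G = ℤ * (ℤ/3ℤ) be the free product of an infinite cyclic group generated by b and a cyclic group of order 3 generated by d. For every integer n ≥ 2, every nontrivial element of the subgroup of G generated by bⁿd and dbⁿ has infinite order. -/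
open Monoid

/-- The action of a group `H` on the free group over `H` by left translation of the basis. -/
def FreeGroup.translate (H : Type*) [Group H] : H →* MulAut (FreeGroup H) where
  toFun h := FreeGroup.freeGroupCongr (Equiv.mulLeft h)
  map_one' := by
    apply MulEquiv.toMonoidHom_injective
    ext x
    simp
  map_mul' h k := by
    apply MulEquiv.toMonoidHom_injective
    ext x
    simp [mul_assoc]

@[simp]
theorem FreeGroup.translate_of {H : Type*} [Group H] (h k : H) :
    FreeGroup.translate H h (FreeGroup.of k) = FreeGroup.of (h * k) := by
  simp [FreeGroup.translate]

namespace Monoid.Coprod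

variable (H : Type*) [Group H]

/-- The homomorphism from `ℤ * H` to the semidirect product of the free group over `H` with `H`. -/
def toSemidirect :
    Coprod (Multiplicative ℤ) H →* FreeGroup H ⋊[FreeGroup.translate H] H :=
  lift (zpowersHom _ (SemidirectProduct.inl (FreeGroup.of 1))) SemidirectProduct.inr

/-- The homomorphism from the semidirect product of the free group over `H` with `H` to `ℤ * H`,
sending the basis element `h` to the conjugate by `h` of the generator of `ℤ`. -/
def ofSemidirect :
    FreeGroup H ⋊[FreeGroup.translate H] H →* Coprod (Multiplicative ℤ) H :=
  SemidirectProduct.lift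
    (FreeGroup.lift fun h => MulAut.conj (inr h) (inl (Multiplicative.ofAdd 1))) inr
    (fun h => by ext k; simp [mul_assoc])

theorem ofSemidirect_comp_toSemidirect :
    (ofSemidirect H).comp (toSemidirect H) = MonoidHom.id _ := by
  ext <;> simp [ofSemidirect, toSemidirect]

theorem toSemidirect_injective : Function.Injective (toSemidirect H) :=
  Function.LeftInverse.injective (g := ofSemidirect H) (DFunLike.congr_fun (ofSemidirect_comp_toSemidirect H))

theorem rightHom_comp_toSemidirect :
    SemidirectProduct.rightHom.comp (toSemidirect H) = snd := by
  ext <;> simp [toSemidirect]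

variable {H}

/-- The kernel of the projection `ℤ * H → H` is torsion-free. -/
theorem eq_one_of_snd_eq_one_of_pow_eq_one {g : Coprod (Multiplicative ℤ) H} (hg : snd g = 1)
    {k : ℕ} (hk : k ≠ 0) (hgk : g ^ k = 1) : g = 1 := by
  rw [← rightHom_comp_toSemidirect, MonoidHom.comp_apply, ← MonoidHom.mem_ker,
    ← SemidirectProduct.range_inl_eq_ker_rightHom] at hg
  obtain ⟨w, hw⟩ := hg
  have hwk : w ^ k = 1 := by
    apply SemidirectProduct.inl_injective (φ := FreeGroup.translate H)
    rw [map_pow, hw, ← map_pow, hgk, map_one, map_one]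
  rw [pow_eq_one_iff_left hk] at hwk
  apply toSemidirect_injective H
  rw [← hw, hwk, map_one, map_one]

end Monoid.Coprod

/-- In `G = ℤ * (ℤ/3ℤ)` with factors generated by `b` and `d`, for every
`n ≥ 2`, every nontrivial element of the subgroup `⟨bⁿd, dbⁿ⟩` has infinite order. -/
theorem infinite_order_in_goeritz_model_subgroup (n : ℕ) (hn : 2 ≤ n) :
    ∀ g ∈ Subgroup.closure {freeProdB ^ n * freeProdD, freeProdD * freeProdB ^ n},
      g ≠ 1 → ∀ k : ℕ, 0 < k → g ^ k ≠ 1 := by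
  intro g hg hg1 k hk hgk
  refine hg1 (Coprod.eq_one_of_snd_eq_one_of_pow_eq_one ?_ hk.ne' hgk)
  have hle : Subgroup.closure {freeProdB ^ n * freeProdD, freeProdD * freeProdB ^ n} ≤
      (Subgroup.zpowers (Multiplicative.ofAdd (n : ℤ), Multiplicative.ofAdd (1 : ZMod 3))).comap
        Coprod.toProd := by
    rw [Subgroup.closure_le]
    rintro x (rfl | rfl) <;> refine ⟨1, ?_⟩ <;>
      simp [freeProdB, freeProdD, ← ofAdd_nsmul]
  obtain ⟨e, he⟩ := Subgroup.mem_zpowers_iff.1 (hle hg)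
  have hfst : Coprod.fst g = 1 := by
    rw [← pow_eq_one_iff_left hk.ne', ← map_pow, hgk, map_one]
  have he0 : e = 0 := by
    have h := congrArg Prod.fst he
    simp only [Coprod.fst_toProd, hfst, Prod.pow_fst, ← ofAdd_zsmul, ofAdd_eq_one] at h
    rw [smul_eq_mul, mul_eq_zero] at h
    omega
  rw [← Coprod.snd_toProd, ← he, he0, zpow_zero, Prod.snd_one]
end

section
/- In the free group F₂ on two generators x and y, the element w = x·y⁻¹·x·y·x⁻¹·y is not primitive: there is no automorphism φ of F₂ with φ(x) = w; equivalently, w does not belong to any free basis of F₂. -/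
/-- A homomorphism from `F₂` that kills the first generator has cyclic image. -/
theorem FreeGroup.map_mem_zpowers_of_map_of_zero_eq_one {G : Type*} [Group G]
    (g : FreeGroup (Fin 2) →* G) (hg : g (FreeGroup.of 0) = 1) (u : FreeGroup (Fin 2)) :
    g u ∈ Subgroup.zpowers (g (FreeGroup.of 1)) := by
  have hof (i : Fin 2) : g (FreeGroup.of i) ∈ Subgroup.zpowers (g (FreeGroup.of 1)) := by
    fin_cases i
    · simp [hg]
    · exact Subgroup.mem_zpowers _
  induction u using FreeGroup.induction_on with
  | C1 => simp
  | of i => exact hof i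
  | inv_of i _ => simpa using hof i
  | mul a b ha hb => simpa using mul_mem ha hb

/-- If a homomorphism kills a primitive element of `F₂`, then its image is commutative. -/
theorem FreeGroup.commute_map_of_map_primitive_eq_one {G : Type*} [Group G]
    (f : FreeGroup (Fin 2) →* G) (φ : MulAut (FreeGroup (Fin 2)))
    (h : f (φ (FreeGroup.of 0)) = 1) (u v : FreeGroup (Fin 2)) : Commute (f u) (f v) := by
  have key (w : FreeGroup (Fin 2)) : f w ∈ Subgroup.zpowers (f (φ (FreeGroup.of 1))) := by
    simpa using map_mem_zpowers_of_map_of_zero_eq_one (f.comp φ.toMonoidHom) h (φ.symm w)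
  obtain ⟨m, hm⟩ := Subgroup.mem_zpowers_iff.mp (key u)
  obtain ⟨n, hn⟩ := Subgroup.mem_zpowers_iff.mp (key v)
  rw [← hm, ← hn]
  exact Commute.zpow_zpow_self _ m n

/-- In the free group `F₂` on generators `x = of 0` and `y = of 1`, the
element `w = x * y⁻¹ * x * y * x⁻¹ * y` is not primitive: no automorphism of `F₂`
sends `x` to `w`. -/
theorem not_primitive_word_example :
    ¬ ∃ φ : MulAut (FreeGroup (Fin 2)),
        φ (FreeGroup.of 0) =
          FreeGroup.of 0 * (FreeGroup.of 1)⁻¹ * FreeGroup.of 0 * FreeGroup.of 1 *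
            (FreeGroup.of 0)⁻¹ * FreeGroup.of 1 := by
  rintro ⟨φ, hφ⟩
  -- Send the generators to two transpositions `a`, `b` of `S₃`; the word goes to `(a * b) ^ 3 = 1`.
  let f : FreeGroup (Fin 2) →* Equiv.Perm (Fin 3) :=
    FreeGroup.lift ![Equiv.swap 0 1, Equiv.swap 1 2]
  have h0 : f (FreeGroup.of 0) = Equiv.swap 0 1 := by simp [f]
  have h1 : f (FreeGroup.of 1) = Equiv.swap 1 2 := by simp [f]
  have hw : f (φ (FreeGroup.of 0)) = 1 := by
    simp only [hφ, map_mul, map_inv, h0, h1]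
    decide
  have hc := FreeGroup.commute_map_of_map_primitive_eq_one f φ hw (FreeGroup.of 0) (FreeGroup.of 1)
  rw [h0, h1, commute_iff_eq] at hc
  exact absurd hc (by decide)
end
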